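/- Suppose that for every Borel set F ⊆ ℝⁿ with Hausdorff dimension greater than n/2, the distance set D(F) = {|x−y| : x, y ∈ F} has positive Lebesgue measure. Then for every Borel set E ⊆ ℝⁿ with Hausdorff dimension greater than n/2, there exist four points x, y, x′, y′ ∈ E with (x, y) ≠ (x′, y′) (as unordered pairs) and |x − y| = |x′ − y′| > 0, i.e., some positive distance is realized at least twice by E. -/

import Mathlib

open MeasureTheory
open scoped ENNReal
open Set Metric Filter Topology

theorem halving {X : Type*} [MeasurableSpace X] [StandardBorelSpace X] (μ : Measure X)
    [IsFiniteMeasure μ] [NullSingletonClass μ] (P : Set X) (hP : MeasurableSet P) :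
    ∃ Q ⊆ P, MeasurableSet Q ∧ μ Q = μ P / 2 := by
  set e := embeddingReal X
  have he : MeasurableEmbedding e := measurableEmbedding_embeddingReal X
  have hm : ∀ t, MeasurableSet (P ∩ e ⁻¹' Iic t) := fun t => hP.inter (he.measurable measurableSet_Iic)
  have hcont : Continuous (fun t : ℝ => μ (P ∩ e ⁻¹' Iic t)) := by
    rw [continuous_iff_continuousAt]
    intro t
    refine tendsto_measure_of_ae_tendsto_indicator_of_isFiniteMeasure _ (hm t) (fun s => hm s) ?_
    have h0 : μ (e ⁻¹' {t}) = 0 := by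
      apply Set.Subsingleton.measure_zero
      intro a ha b hb
      exact he.injective (by rw [mem_preimage, mem_singleton_iff] at ha hb; rw [ha, hb])
    rw [measure_eq_zero_iff_ae_notMem] at h0
    filter_upwards [h0] with x hx
    have hx : e x ≠ t := hx
    rcases lt_or_gt_of_ne hx with h | h
    · filter_upwards [lt_mem_nhds h] with s hs
      simp [h.le, hs.le]
    · filter_upwards [gt_mem_nhds h] with s hs
      simp [not_le.2 h, not_le.2 hs]
  have h1 : Tendsto (fun t : ℝ => μ (P ∩ e ⁻¹' Iic t)) atTop (𝓝 (μ P)) := by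
    refine tendsto_measure_of_ae_tendsto_indicator_of_isFiniteMeasure _ hP (fun s => hm s) ?_
    refine Eventually.of_forall fun x => ?_
    filter_upwards [eventually_ge_atTop (e x)] with s hs
    simp [hs]
  have h2 : Tendsto (fun t : ℝ => μ (P ∩ e ⁻¹' Iic t)) atBot (𝓝 (μ ∅)) := by
    refine tendsto_measure_of_ae_tendsto_indicator_of_isFiniteMeasure _ MeasurableSet.empty (fun s => hm s) ?_
    refine Eventually.of_forall fun x => ?_
    filter_upwards [eventually_lt_atBot (e x)] with s hs
    simp [hs]
  by_cases h0 : μ P = 0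
  · exact ⟨∅, empty_subset _, MeasurableSet.empty, by simp [h0]⟩
  have hlt : μ P / 2 < μ P := ENNReal.half_lt_self h0 (measure_ne_top _ _)
  have hpos : μ ∅ < μ P / 2 := by simpa [pos_iff_ne_zero] using h0
  obtain ⟨a, ha⟩ := (h2.eventually (gt_mem_nhds hpos)).exists
  obtain ⟨b, hb⟩ := (h1.eventually (lt_mem_nhds hlt)).exists
  obtain ⟨t, ht⟩ := mem_range_of_exists_le_of_exists_ge hcont ⟨a, ha.le⟩ ⟨b, hb.le⟩
  exact ⟨_, inter_subset_left, hm t, ht⟩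


theorem thinning {X : Type*} [MetricSpace X] [ProperSpace X] [MeasurableSpace X] [BorelSpace X]
    (μ : Measure X) [IsFiniteMeasure μ] [NullSingletonClass μ] (K : Set X) (hK : MeasurableSet K)
    (δ : ℝ) (hδ : 0 < δ) :
    ∃ L ⊆ K, MeasurableSet L ∧ 2 * μ L = μ K ∧
      ∀ x r, 2 * μ (L ∩ ball x r) ≤ μ (K ∩ ball x (r + 2 * δ)) := by
  rcases isEmpty_or_nonempty X with hX | hX
  · refine ⟨∅, empty_subset _, MeasurableSet.empty, ?_, fun x => (hX.false x).elim⟩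
    have : K = ∅ := Set.eq_empty_of_isEmpty K
    simp [this]
  set p := TopologicalSpace.denseSeq X
  have hp : DenseRange p := TopologicalSpace.denseRange_denseSeq X
  set P : ℕ → Set X := fun j => K ∩ disjointed (fun i => ball (p i) δ) j with hPdef
  have hPm : ∀ j, MeasurableSet (P j) := fun j =>
    hK.inter (MeasurableSet.disjointed (fun i => measurableSet_ball) j)
  have hPd : Pairwise (Function.onFun Disjoint P) := fun i j hij =>
    (disjoint_disjointed _ hij).mono inter_subset_right inter_subset_right
  have hPU : ⋃ j, P j = K := by
    rw [← inter_iUnion, iUnion_disjointed]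
    refine inter_eq_left.2 fun x _ => ?_
    obtain ⟨i, hi⟩ := hp.exists_dist_lt x hδ
    exact mem_iUnion.2 ⟨i, hi⟩
  have hPdist : ∀ j, ∀ x ∈ P j, ∀ y ∈ P j, dist x y < 2 * δ := by
    intro j x hx y hy
    have h1 : dist x (p j) < δ :=
      mem_ball.1 (disjointed_subset (fun i => ball (p i) δ) j hx.2)
    have h2 : dist y (p j) < δ :=
      mem_ball.1 (disjointed_subset (fun i => ball (p i) δ) j hy.2)
    have := dist_triangle_right x y (p j)
    linarith
  choose Q hQP hQm hQ using fun j => halving μ (P j) (hPm j)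
  have hQ2 : ∀ j, 2 * μ (Q j) = μ (P j) := fun j => by
    rw [hQ, ENNReal.mul_div_cancel (by simp) (by simp)]
  have hQd : Pairwise (Function.onFun Disjoint Q) := fun i j hij =>
    (hPd hij).mono (hQP i) (hQP j)
  have key : ∀ S : Set ℕ, 2 * μ (⋃ j ∈ S, Q j) = μ (⋃ j ∈ S, P j) := by
    intro S
    rw [measure_biUnion S.to_countable (fun i _ j _ hij => hQd hij) (fun j _ => hQm j),
      measure_biUnion S.to_countable (fun i _ j _ hij => hPd hij) (fun j _ => hPm j),
      ← ENNReal.tsum_mul_left]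
    simp only [hQ2]
  refine ⟨⋃ j, Q j, ?_, MeasurableSet.iUnion hQm, ?_, ?_⟩
  · rw [← hPU]; exact iUnion_mono hQP
  · have := key univ
    simpa [hPU] using this
  · intro x r
    set S : Set ℕ := {j | (P j ∩ ball x r).Nonempty}
    calc 2 * μ ((⋃ j, Q j) ∩ ball x r) ≤ 2 * μ (⋃ j ∈ S, Q j) := by
          gcongr
          rintro y ⟨hy, hyr⟩
          obtain ⟨j, hj⟩ := mem_iUnion.1 hy
          exact mem_iUnion₂.2 ⟨j, ⟨y, hQP j hj, hyr⟩, hj⟩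
      _ = μ (⋃ j ∈ S, P j) := key S
      _ ≤ _ := by
          gcongr
          intro y hy
          obtain ⟨j, ⟨z, hz, hzr⟩, hj⟩ := mem_iUnion₂.1 hy
          refine ⟨hj.1, ?_⟩
          have := hPdist j y hj z hz
          have h3 := dist_triangle y z x
          rw [mem_ball] at hzr ⊢
          linarith

theorem cantor_step {X : Type*} [MetricSpace X] [ProperSpace X] [MeasurableSpace X] [BorelSpace X]
    (μ : Measure X) [IsFiniteMeasure μ] [NullSingletonClass μ] (s t M : ℝ) (ht : 0 < t) (hst : t < s)
    (hM0 : 0 < M)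
    (hM : ∀ x, ∀ r > 0, μ (ball x r) ≤ ENNReal.ofReal (M * r ^ s)) (i : ℕ) (K : Set X)
    (hK : IsCompact K) (C C' : ℝ) (hC0 : 0 < C) (hCC' : C < C')
    (hC : ∀ x, ∀ r > 0, 2 ^ i * μ (K ∩ ball x r) ≤ ENNReal.ofReal (C * r ^ t))
    (m : ℝ≥0∞) (hm : m < 2 ^ i * μ K) :
    ∃ L ⊆ K, IsCompact L ∧ m < 2 ^ (i + 1) * μ L ∧ 2 * μ L ≤ μ K ∧
      ∀ x, ∀ r > 0, 2 ^ (i + 1) * μ (L ∩ ball x r) ≤ ENNReal.ofReal (C' * r ^ t) := by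
  have hC'0 : 0 < C' := hC0.trans hCC'
  -- small scale
  obtain ⟨ρ, hρ0, hρ⟩ : ∃ ρ : ℝ, 0 < ρ ∧ 2 ^ (i + 1) * M * ρ ^ (s - t) ≤ C' := by
    have : Tendsto (fun ρ : ℝ => 2 ^ (i + 1) * M * ρ ^ (s - t)) (𝓝[>] 0) (𝓝 0) := by
      have h1 : ContinuousAt (fun ρ : ℝ => 2 ^ (i + 1) * M * ρ ^ (s - t)) 0 :=
        continuousAt_const.mul (Real.continuousAt_rpow_const _ _ (Or.inr (by linarith)))
      have h2 := h1.tendsto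
      rw [Real.zero_rpow (by linarith), mul_zero] at h2
      exact h2.mono_left nhdsWithin_le_nhds
    obtain ⟨ρ, h, h'⟩ := ((this.eventually (gt_mem_nhds hC'0)).and self_mem_nhdsWithin).exists
    exact ⟨ρ, h', h.le⟩
  obtain ⟨δ, hδ0, hδ⟩ : ∃ δ : ℝ, 0 < δ ∧ C * (1 + 2 * δ / ρ) ^ t ≤ C' := by
    have : Tendsto (fun δ : ℝ => C * (1 + 2 * δ / ρ) ^ t) (𝓝[>] 0) (𝓝 C) := by
      have h1 : ContinuousAt (fun δ : ℝ => C * (1 + 2 * δ / ρ) ^ t) 0 := by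
        refine continuousAt_const.mul (ContinuousAt.rpow_const (by fun_prop) (Or.inr ht.le))
      have h2 := h1.tendsto
      simp only [mul_zero, zero_div, add_zero, Real.one_rpow, mul_one] at h2
      exact h2.mono_left nhdsWithin_le_nhds
    obtain ⟨ρ, h, h'⟩ := ((this.eventually (gt_mem_nhds hCC')).and self_mem_nhdsWithin).exists
    exact ⟨ρ, h', h.le⟩
  obtain ⟨L', hL'K, hL'm, hL'2, hL'b⟩ := thinning μ K hK.measurableSet δ hδ0
  have hm' : m / 2 ^ (i + 1) < μ L' := by
    rw [ENNReal.div_lt_iff (by simp) (by simp), mul_comm, pow_succ, mul_assoc, hL'2]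
    exact hm
  obtain ⟨L, hLL', hLc, hLm⟩ := hL'm.exists_lt_isCompact hm'
  refine ⟨L, hLL'.trans hL'K, hLc, ?_, ?_, ?_⟩
  · rwa [ENNReal.div_lt_iff (by simp) (by simp), mul_comm] at hLm
  · rw [← hL'2]; gcongr
  · intro x r hr
    rcases le_total r ρ with h | h
    · calc 2 ^ (i + 1) * μ (L ∩ ball x r) ≤ 2 ^ (i + 1) * ENNReal.ofReal (M * r ^ s) := by
            gcongr
            exact (measure_mono inter_subset_right).trans (hM x r hr)
        _ = ENNReal.ofReal (2 ^ (i + 1) * (M * r ^ s)) := by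
            rw [ENNReal.ofReal_mul (p := 2 ^ (i + 1)) (by positivity), ENNReal.ofReal_pow (by norm_num)]
            simp
        _ ≤ _ := by
            apply ENNReal.ofReal_le_ofReal
            have h1 : r ^ s = r ^ (s - t) * r ^ t := by
              rw [← Real.rpow_add hr]; congr 1; ring
            have h2 : r ^ (s - t) ≤ ρ ^ (s - t) :=
              Real.rpow_le_rpow hr.le h (by linarith)
            calc 2 ^ (i + 1) * (M * r ^ s) = (2 ^ (i + 1) * M * r ^ (s - t)) * r ^ t := by
                  rw [h1]; ring
              _ ≤ (2 ^ (i + 1) * M * ρ ^ (s - t)) * r ^ t := by gcongr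
              _ ≤ _ := by gcongr
    · calc 2 ^ (i + 1) * μ (L ∩ ball x r) ≤ 2 ^ i * (2 * μ (L' ∩ ball x r)) := by
            rw [pow_succ, mul_assoc]; gcongr
        _ ≤ 2 ^ i * μ (K ∩ ball x (r + 2 * δ)) := by gcongr; exact hL'b x r
        _ ≤ ENNReal.ofReal (C * (r + 2 * δ) ^ t) := hC x _ (by linarith)
        _ ≤ _ := by
            apply ENNReal.ofReal_le_ofReal
            have h1 : r + 2 * δ ≤ (1 + 2 * δ / ρ) * r := by
              have : 2 * δ ≤ 2 * δ / ρ * r := by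
                rw [div_mul_eq_mul_div, le_div_iff₀ hρ0]; gcongr
              linarith
            calc C * (r + 2 * δ) ^ t ≤ C * ((1 + 2 * δ / ρ) * r) ^ t := by gcongr
              _ = C * (1 + 2 * δ / ρ) ^ t * r ^ t := by
                  rw [Real.mul_rpow (by positivity) hr.le]; ring
              _ ≤ _ := by gcongr

/-- mass distribution principle for a decreasing sequence of compact sets -/
theorem mass_dist {X : Type*} [MetricSpace X] [ProperSpace X] [MeasurableSpace X] [BorelSpace X]
    (μ : Measure X) (t : NNReal) (ht : 0 < t) (K : ℕ → Set X)
    (hK : ∀ i, IsCompact (K i)) (hKa : Antitone K) (C : ℝ) (hC0 : 0 < C) (m : ℝ≥0∞) (hm0 : 0 < m)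
    (hm : ∀ i, m ≤ 2 ^ i * μ (K i))
    (hC : ∀ i, ∀ x, ∀ r > 0, 2 ^ i * μ (K i ∩ ball x r) ≤ ENNReal.ofReal (C * r ^ (t : ℝ))) :
    (t : ℝ≥0∞) ≤ dimH (⋂ i, K i) := by
  apply le_dimH_of_hausdorffMeasure_ne_zero
  intro h0
  have ht' : (0 : ℝ) < t := ht
  set c := ENNReal.ofReal C
  have hc0 : c ≠ 0 := by simpa [c] using hC0
  set ε : ℝ≥0∞ := m / c / 2 with hε
  have hε0 : ε ≠ 0 := by simp [hε, ENNReal.div_eq_zero_iff, hm0.ne', c]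
  rw [Measure.hausdorffMeasure_apply] at h0
  have h1 := (iSup₂_eq_bot.1 h0) 1 one_pos
  obtain ⟨U, hU⟩ := iInf_lt_iff.1 (h1.trans_lt (bot_lt_iff_ne_bot.2 hε0))
  obtain ⟨hUc, hU⟩ := iInf_lt_iff.1 hU
  obtain ⟨hUd, hU⟩ := iInf_lt_iff.1 hU
  obtain ⟨e, he0, he⟩ := ENNReal.exists_pos_sum_of_countable hε0 ℕ
  -- radii
  set ρ : ℕ → ℝ := fun k => ((ediam (U k)).toReal ^ (t : ℝ) + e k) ^ (1 / (t : ℝ)) with hρ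
  have hρt : ∀ k, ρ k ^ (t : ℝ) = (ediam (U k)).toReal ^ (t : ℝ) + e k := by
    intro k
    rw [hρ]
    simp only [one_div]
    rw [Real.rpow_inv_rpow (by positivity) ht'.ne']
  have hρpos : ∀ k, 0 < ρ k := fun k => by
    have : (0 : ℝ) < e k := he0 k
    simp only [hρ]; positivity
  have hρlt : ∀ k, (ediam (U k)).toReal < ρ k := fun k => by
    have : (0 : ℝ) < e k := he0 k
    rw [← Real.rpow_lt_rpow_iff (by positivity) (hρpos k).le ht', hρt]
    linarith
  have hdt : ∀ k, ediam (U k) ≠ ∞ := fun k => ((hUd k).trans_lt ENNReal.one_lt_top).ne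
  -- balls
  have hV : ∀ k, ∃ V : Set X, IsOpen V ∧ U k ⊆ V ∧
      ∀ i, 2 ^ i * μ (K i ∩ V) ≤ c * ((⨆ _ : (U k).Nonempty, ediam (U k) ^ (t : ℝ)) + e k) := by
    intro k
    rcases (U k).eq_empty_or_nonempty with h | h
    · exact ⟨∅, isOpen_empty, h.subset, by simp⟩
    · obtain ⟨x, hx⟩ := h
      refine ⟨ball x (ρ k), isOpen_ball, ?_, ?_⟩
      · intro y hy
        rw [mem_ball]
        refine lt_of_le_of_lt ?_ (hρlt k)
        rw [dist_edist]
        exact ENNReal.toReal_mono (hdt k) (edist_le_ediam_of_mem hy hx)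
      · intro i
        refine (hC i x (ρ k) (hρpos k)).trans ?_
        rw [ENNReal.ofReal_mul hC0.le, hρt, ENNReal.ofReal_add (by positivity) (by positivity)]
        rw [iSup_pos ⟨x, hx⟩, ← ENNReal.ofReal_rpow_of_nonneg (by positivity) ht'.le,
          ENNReal.ofReal_toReal (hdt k)]
        simp [c]
  choose V hVo hUV hVb using hV
  obtain ⟨i, hi⟩ := exists_subset_nhds_of_isCompact (directed_of_isDirected_le hKa) hK
    (U := ⋃ k, V k) (fun x hx => (isOpen_iUnion hVo).mem_nhds (iUnion_mono hUV (hUc hx)))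
  have : m < m := by
    calc m ≤ 2 ^ i * μ (K i) := hm i
      _ = 2 ^ i * μ (⋃ k, K i ∩ V k) := by rw [← inter_iUnion, inter_eq_left.2 hi]
      _ ≤ 2 ^ i * ∑' k, μ (K i ∩ V k) := by gcongr; exact measure_iUnion_le _
      _ = ∑' k, 2 ^ i * μ (K i ∩ V k) := ENNReal.tsum_mul_left.symm
      _ ≤ ∑' k, c * ((⨆ _ : (U k).Nonempty, ediam (U k) ^ (t : ℝ)) + e k) :=
          ENNReal.tsum_le_tsum fun k => hVb k i
      _ = c * (∑' k, (⨆ _ : (U k).Nonempty, ediam (U k) ^ (t : ℝ)) + ∑' k, (e k : ℝ≥0∞)) := by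
          rw [ENNReal.tsum_mul_left, ENNReal.tsum_add]
      _ < c * (ε + ε) := by
          rw [ENNReal.mul_lt_mul_iff_right hc0 (by simp [c])]
          exact ENNReal.add_lt_add hU he
      _ = m := by
          rw [hε, ENNReal.add_halves, ENNReal.mul_div_cancel hc0 (by simp [c])]
  exact lt_irrefl _ this

theorem cantor_exists {X : Type*} [MetricSpace X] [ProperSpace X] [MeasurableSpace X] [BorelSpace X]
    (μ : Measure X) [IsFiniteMeasure μ] (s : ℝ) (t : NNReal) (M : ℝ)
    (ht : 0 < t) (hst : t < s) (hM0 : 0 < M)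
    (hM : ∀ x, ∀ r > 0, μ (ball x r) ≤ ENNReal.ofReal (M * r ^ s)) (K : Set X)
    (hK : IsCompact K) (hK0 : μ K ≠ 0) :
    ∃ F ⊆ K, IsCompact F ∧ μ F = 0 ∧ (t : ℝ≥0∞) ≤ dimH F := by
  have ht' : (0 : ℝ) < t := ht
  have : NullSingletonClass μ := by
    refine ⟨fun x => ?_⟩
    have h1 : Tendsto (fun r : ℝ => ENNReal.ofReal (M * r ^ s)) (𝓝[>] 0) (𝓝 0) := by
      have h1 : ContinuousAt (fun r : ℝ => ENNReal.ofReal (M * r ^ s)) 0 :=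
        ENNReal.continuous_ofReal.continuousAt.comp
          (continuousAt_const.mul (Real.continuousAt_rpow_const _ _ (Or.inr (by linarith))))
      have h2 := h1.tendsto
      rw [Real.zero_rpow (by linarith), mul_zero, ENNReal.ofReal_zero] at h2
      exact h2.mono_left nhdsWithin_le_nhds
    refine le_antisymm (ge_of_tendsto h1 ?_) zero_le
    filter_upwards [self_mem_nhdsWithin] with r hr
    exact (measure_mono (singleton_subset_iff.2 (mem_ball_self hr))).trans (hM x r hr)
  set C0 : ℝ := max M (μ.real univ) with hC0
  have hC0pos : 0 < C0 := lt_max_of_lt_left hM0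
  have hbase : ∀ x, ∀ r > 0, μ (ball x r) ≤ ENNReal.ofReal (C0 * r ^ (t : ℝ)) := by
    intro x r hr
    rcases le_total r 1 with h | h
    · refine (hM x r hr).trans (ENNReal.ofReal_le_ofReal ?_)
      exact mul_le_mul (le_max_left _ _) (Real.rpow_le_rpow_of_exponent_ge hr h hst.le)
        (by positivity) hC0pos.le
    · refine (measure_mono (subset_univ _)).trans ?_
      rw [← ofReal_measureReal]
      apply ENNReal.ofReal_le_ofReal
      calc μ.real univ ≤ C0 := le_max_right _ _
        _ = C0 * 1 := (mul_one _).symm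
        _ ≤ _ := by
          gcongr
          exact Real.one_le_rpow h ht'.le
  set m := μ K / 2
  have hm0 : 0 < m := ENNReal.half_pos hK0
  have hmK : m < μ K := ENNReal.half_lt_self hK0 (measure_ne_top _ _)
  let Good : ℕ → Set X → Prop := fun i L => IsCompact L ∧ m < 2 ^ i * μ L ∧ 2 ^ i * μ L ≤ μ K ∧
    ∃ C, 0 < C ∧ C < 2 * C0 ∧
      ∀ x, ∀ r > 0, 2 ^ i * μ (L ∩ ball x r) ≤ ENNReal.ofReal (C * r ^ (t : ℝ))
  have hstep : ∀ i, ∀ L : {L // Good i L}, ∃ L' : {L // Good (i + 1) L}, L'.1 ⊆ L.1 := by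
    rintro i ⟨L, hLc, hLm, hLK, C, hCp, hCC, hC⟩
    obtain ⟨L', h1, h2, h3, h4, h5⟩ := cantor_step μ s t M ht' hst hM0 hM i L hLc C
      ((C + 2 * C0) / 2) hCp (by linarith) hC m hLm
    refine ⟨⟨L', h2, h3, ?_, (C + 2 * C0) / 2, by linarith, by linarith, h5⟩, h1⟩
    refine le_trans ?_ hLK
    rw [pow_succ, mul_assoc]
    gcongr
  choose next hnext using hstep
  have hGood0 : Good 0 K := ⟨hK, by simpa using hmK, by simp, C0, hC0pos, by linarith,
    fun x r hr => by
      rw [pow_zero, one_mul]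
      exact (measure_mono inter_subset_right).trans (hbase x r hr)⟩
  let seq : ∀ i, {L // Good i L} := fun i => Nat.rec ⟨K, hGood0⟩ (fun i L => next i L) i
  have hanti : Antitone fun i => (seq i).1 := antitone_nat_of_succ_le fun i => hnext i (seq i)
  refine ⟨⋂ i, (seq i).1, iInter_subset _ 0, ?_, ?_, ?_⟩
  · exact hK.of_isClosed_subset (isClosed_iInter fun i => (seq i).2.1.isClosed) (iInter_subset _ 0)
  · by_contra hne
    have hb : ∀ i : ℕ, 2 ^ i * μ (⋂ i, (seq i).1) ≤ μ K := fun i =>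
      le_trans (by gcongr; exact iInter_subset _ i) (seq i).2.2.2.1
    have h1 : Tendsto (fun i : ℕ => (2 : ℝ≥0∞) ^ i * μ (⋂ i, (seq i).1)) atTop (𝓝 ∞) := by
      have := ENNReal.Tendsto.mul_const (b := μ (⋂ i, (seq i).1))
        (ENNReal.tendsto_pow_atTop_nhds_top_iff.2 (show (1 : ℝ≥0∞) < 2 by norm_num))
        (Or.inl (by simp))
      rwa [ENNReal.top_mul hne] at this
    exact measure_ne_top μ K (top_le_iff.1 (le_of_tendsto' h1 hb))
  · refine mass_dist μ t ht (fun i => (seq i).1) (fun i => (seq i).2.1) hanti (2 * C0)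
      (by linarith) m hm0 (fun i => (seq i).2.2.1.le) ?_
    intro i x r hr
    obtain ⟨C, hCp, hCC, hC⟩ := (seq i).2.2.2.2
    refine (hC x r hr).trans (ENNReal.ofReal_le_ofReal ?_)
    gcongr

theorem upper_density {X : Type*} [MetricSpace X] [ProperSpace X] [MeasurableSpace X] [BorelSpace X]
    (μ : Measure X) [IsFiniteMeasure μ] (s : NNReal) (B : Set X)
    (hB : ∀ x ∈ B, ∀ δ > 0, ∃ r, 0 < r ∧ r < δ ∧ ENNReal.ofReal (r ^ (s : ℝ)) < μ (ball x r)) :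
    dimH B ≤ s := by
  apply dimH_le_of_hausdorffMeasure_ne_top
  have hs0 : (0 : ℝ) ≤ s := s.2
  let T : ℕ → Set (X × ℝ) := fun k => {p | p.1 ∈ B ∧ 0 < p.2 ∧ p.2 < 1 / ((k : ℝ) + 1) ∧
    ENNReal.ofReal (p.2 ^ (s : ℝ)) < μ (ball p.1 p.2)}
  have hvit := fun k => Vitali.exists_disjoint_subfamily_covering_enlargement_closedBall (T k)
    (fun p : X × ℝ => p.1) (fun p => p.2) (1 / ((k : ℝ) + 1)) (fun a ha => ha.2.2.1.le) 5
    (by norm_num)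
  choose u huT hud hucov using hvit
  have hucount : ∀ k, (u k).Countable := fun k => by
    refine (hud k).countable_of_nonempty_interior fun p hp => ?_
    exact ⟨p.1, ball_subset_interior_closedBall (mem_ball_self (huT k hp).2.1)⟩
  have := fun k => (hucount k).to_subtype
  have hdiam : ∀ (k : ℕ) (p : u k), ediam (closedBall p.1.1 (5 * p.1.2)) ≤
      ENNReal.ofReal (10 * p.1.2) := by
    intro k p
    refine ediam_le fun x hx y hy => ?_
    rw [edist_dist]
    apply ENNReal.ofReal_le_ofReal
    have h1 := dist_triangle_right x y p.1.1
    rw [mem_closedBall] at hx hy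
    linarith
  have hle := Measure.hausdorffMeasure_le_liminf_tsum (l := atTop) (s : ℝ) B
    (fun k : ℕ => ENNReal.ofReal (10 * (1 / ((k : ℝ) + 1)))) ?_
    (fun k (p : u k) => closedBall p.1.1 (5 * p.1.2)) ?_ ?_
  · refine ne_top_of_le_ne_top (b := ENNReal.ofReal (10 ^ (s : ℝ)) * μ univ)
      (ENNReal.mul_ne_top (by simp) (measure_ne_top _ _)) (hle.trans ?_)
    refine liminf_le_of_frequently_le' (Frequently.of_forall fun k => ?_)
    calc ∑' p : u k, ediam (closedBall p.1.1 (5 * p.1.2)) ^ (s : ℝ)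
        ≤ ∑' p : u k, ENNReal.ofReal (10 ^ (s : ℝ)) * μ (closedBall p.1.1 p.1.2) := by
          refine ENNReal.tsum_le_tsum fun p => ?_
          have hp := huT k p.2
          calc _ ≤ ENNReal.ofReal (10 * p.1.2) ^ (s : ℝ) :=
                ENNReal.rpow_le_rpow (hdiam k p) hs0
            _ = ENNReal.ofReal (10 ^ (s : ℝ)) * ENNReal.ofReal (p.1.2 ^ (s : ℝ)) := by
                rw [ENNReal.ofReal_rpow_of_nonneg (by linarith [hp.2.1]) hs0,
                  Real.mul_rpow (by norm_num) hp.2.1.le, ENNReal.ofReal_mul (by positivity)]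
            _ ≤ _ := by
                gcongr
                exact hp.2.2.2.le.trans (measure_mono ball_subset_closedBall)
      _ = ENNReal.ofReal (10 ^ (s : ℝ)) * ∑' p : u k, μ (closedBall p.1.1 p.1.2) :=
          ENNReal.tsum_mul_left
      _ ≤ _ := by
          gcongr
          refine tsum_measure_le_measure_univ
            (fun p => measurableSet_closedBall.nullMeasurableSet) ?_
          intro p q hpq
          exact (hud k p.2 q.2 (fun h => hpq (Subtype.ext h))).aedisjoint
  · have h1 := (tendsto_one_div_add_atTop_nhds_zero_nat (𝕜 := ℝ)).const_mul 10
    have := ENNReal.tendsto_ofReal h1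
    simpa using this
  · refine Eventually.of_forall fun k p => (hdiam k p).trans (ENNReal.ofReal_le_ofReal ?_)
    have := (huT k p.2).2.2.1
    gcongr
  · refine Eventually.of_forall fun k x hx => ?_
    obtain ⟨r, hr0, hr, hrμ⟩ := hB x hx (1 / ((k : ℝ) + 1)) (by positivity)
    obtain ⟨b, hb, hsub⟩ := hucov k (x, r) ⟨hx, hr0, hr, hrμ⟩
    exact mem_iUnion.2 ⟨⟨b, hb⟩, hsub (mem_closedBall_self hr0.le)⟩

theorem exists_null_subset {X : Type*} [MetricSpace X] [ProperSpace X] [MeasurableSpace X]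
    [BorelSpace X] (μ : Measure X) [IsFiniteMeasure μ] (E : Set X) (hE : MeasurableSet E)
    (c : ℝ≥0∞) (hc : c < dimH E) :
    ∃ F ⊆ E, MeasurableSet F ∧ μ F = 0 ∧ c < dimH F := by
  obtain ⟨t, hct, htE⟩ := ENNReal.lt_iff_exists_nnreal_btwn.1 hc
  obtain ⟨s, hts, hsE⟩ := ENNReal.lt_iff_exists_nnreal_btwn.1 htE
  have hts : t < s := by exact_mod_cast hts
  have ht0 : 0 < t := by
    have : (0 : ℝ≥0∞) < t := zero_le.trans_lt hct
    exact_mod_cast this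
  have hs0 : (0 : ℝ) < s := by exact_mod_cast ht0.trans hts
  let A : ℕ → Set X := fun j => {x | ∀ r, 0 < r → r < 1 / ((j : ℝ) + 1) →
    μ (ball x r) ≤ ENNReal.ofReal (r ^ (s : ℝ))}
  have hball : ∀ (r : ℝ) (a : ℝ≥0∞), IsClosed {x | μ (ball x r) ≤ a} := by
    intro r a
    rw [← isOpen_compl_iff, isOpen_iff_mem_nhds]
    intro x hx
    have hx : a < μ (ball x r) := not_le.1 hx
    have hU : ball x r = ⋃ k : ℕ, ball x (r - 1 / ((k : ℝ) + 1)) := by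
      ext y
      simp only [mem_ball, mem_iUnion]
      constructor
      · intro h
        obtain ⟨k, hk⟩ := exists_nat_one_div_lt (sub_pos.2 h)
        exact ⟨k, by linarith⟩
      · rintro ⟨k, hk⟩
        have : 0 < 1 / ((k : ℝ) + 1) := by positivity
        linarith
    have hmono : Monotone fun k : ℕ => ball x (r - 1 / ((k : ℝ) + 1)) := by
      intro i j hij
      apply ball_subset_ball
      have : (1 : ℝ) / (j + 1) ≤ 1 / (i + 1) := by gcongr
      linarith
    rw [hU, hmono.measure_iUnion] at hx
    obtain ⟨k, hk⟩ := lt_iSup_iff.1 hx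
    filter_upwards [ball_mem_nhds x (show 0 < 1 / ((k : ℝ) + 1) by positivity)] with y hy
    refine not_le.2 (hk.trans_le (measure_mono (ball_subset_ball' ?_)))
    rw [dist_comm]
    have := mem_ball.1 hy
    linarith
  have hA : ∀ j, IsClosed (A j) := by
    intro j
    have : A j = ⋂ r : ℝ, ⋂ _ : 0 < r, ⋂ _ : r < 1 / ((j : ℝ) + 1),
        {x | μ (ball x r) ≤ ENNReal.ofReal (r ^ (s : ℝ))} := by
      ext x; simp [A]
    rw [this]
    exact isClosed_iInter fun r => isClosed_iInter fun _ => isClosed_iInter fun _ => hball _ _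
  set B : Set X := (⋃ j, A j)ᶜ with hBdef
  have hBdim : dimH B ≤ s := by
    refine upper_density μ s B fun x hx δ hδ => ?_
    obtain ⟨j, hj⟩ := exists_nat_one_div_lt hδ
    have hxj : x ∉ A j := fun h => hx (mem_iUnion.2 ⟨j, h⟩)
    simp only [A, mem_ofPred_eq, not_forall, not_le] at hxj
    obtain ⟨r, h1, h2, h3⟩ := hxj
    exact ⟨r, h1, h2.trans hj, h3⟩
  obtain ⟨j, hj⟩ : ∃ j, (s : ℝ≥0∞) < dimH (E ∩ A j) := by
    by_contra! hcon
    have hsub : E ⊆ B ∪ ⋃ j, E ∩ A j := by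
      intro x hx
      by_cases h : x ∈ ⋃ j, A j
      · right; rw [← inter_iUnion]; exact ⟨hx, h⟩
      · left; exact h
    have := dimH_mono hsub
    rw [dimH_union, dimH_iUnion] at this
    exact absurd (this.trans (max_le hBdim (iSup_le hcon))) (not_le.2 hsE)
  have hEA : MeasurableSet (E ∩ A j) := hE.inter (hA j).measurableSet
  by_cases h0 : μ (E ∩ A j) = 0
  · refine ⟨E ∩ A j, inter_subset_left, hEA, h0, (hct.trans ?_).trans hj⟩
    exact_mod_cast hts
  obtain ⟨K, hKE, hK, hKpos⟩ := hEA.exists_lt_isCompact (pos_iff_ne_zero.2 h0)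
  set δ : ℝ := 1 / ((j : ℝ) + 1) with hδ
  have hδ0 : 0 < δ := by positivity
  set M : ℝ := max (2 ^ (s : ℝ)) (μ.real univ / (δ / 2) ^ (s : ℝ)) with hMdef
  have hM0 : 0 < M := lt_max_of_lt_left (by positivity)
  have hM : ∀ x, ∀ r > 0, (μ.restrict K) (ball x r) ≤ ENNReal.ofReal (M * r ^ (s : ℝ)) := by
    intro x r hr
    rw [Measure.restrict_apply measurableSet_ball]
    rcases lt_or_ge r (δ / 2) with h | h
    · rcases (ball x r ∩ K).eq_empty_or_nonempty with he | ⟨y, hyr, hyK⟩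
      · simp [he]
      · have hsub : ball x r ∩ K ⊆ ball y (2 * r) := by
          refine inter_subset_left.trans (ball_subset_ball' ?_)
          rw [dist_comm]
          have := mem_ball.1 hyr
          linarith
        refine (measure_mono hsub).trans (((hKE hyK).2 (2 * r) (by linarith) (by linarith)).trans
          (ENNReal.ofReal_le_ofReal ?_))
        rw [Real.mul_rpow (by norm_num) hr.le]
        gcongr
        exact le_max_left _ _
    · refine (measure_mono (subset_univ _)).trans ?_
      rw [← ofReal_measureReal]
      apply ENNReal.ofReal_le_ofReal
      calc μ.real univ = μ.real univ / (δ / 2) ^ (s : ℝ) * (δ / 2) ^ (s : ℝ) := by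
            field_simp
        _ ≤ M * r ^ (s : ℝ) := by
            gcongr
            exact le_max_right _ _
  obtain ⟨F, hFK, hF, hF0, hFd⟩ := cantor_exists (μ.restrict K) s t M ht0 (by exact_mod_cast hts)
    hM0 hM K hK (by rw [Measure.restrict_apply_self]; exact hKpos.ne')
  refine ⟨F, hFK.trans (hKE.trans inter_subset_left), hF.measurableSet, ?_, hct.trans_le hFd⟩
  rwa [Measure.restrict_apply hF.measurableSet, inter_eq_left.2 hFK] at hF0

/-- the distance set conjecture in dimension `n` implies that every
Borel set of Hausdorff dimension greater than `n/2` realizes some positive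
distance at least twice. -/
theorem stmt3 (n : ℕ)
    (H : ∀ F : Set (EuclideanSpace ℝ (Fin n)), MeasurableSet F →
      (n : ℝ≥0∞) / 2 < dimH F →
      0 < volume {r : ℝ | ∃ x ∈ F, ∃ y ∈ F, r = dist x y}) :
    ∀ E : Set (EuclideanSpace ℝ (Fin n)), MeasurableSet E →
      (n : ℝ≥0∞) / 2 < dimH E →
      ∃ x ∈ E, ∃ y ∈ E, ∃ x' ∈ E, ∃ y' ∈ E,
        ({x, y} : Set (EuclideanSpace ℝ (Fin n))) ≠ {x', y'} ∧
        dist x y = dist x' y' ∧ 0 < dist x y := by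
  intro E hE hdim
  by_contra! hcon
  set e := embeddingReal (EuclideanSpace ℝ (Fin n))
  have he : MeasurableEmbedding e := measurableEmbedding_embeddingReal (EuclideanSpace ℝ (Fin n))
  set T : Set ((EuclideanSpace ℝ (Fin n)) × (EuclideanSpace ℝ (Fin n))) := {p | p.1 ∈ E ∧ p.2 ∈ E ∧ e p.1 < e p.2} with hTdef
  have hT : MeasurableSet T :=
    (measurable_fst hE).inter ((measurable_snd hE).inter
      (measurableSet_lt (he.measurable.comp measurable_fst) (he.measurable.comp measurable_snd)))
  set d : (EuclideanSpace ℝ (Fin n)) × (EuclideanSpace ℝ (Fin n)) → ℝ := fun p => dist p.1 p.2 with hd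
  have hinj : InjOn d T := by
    rintro ⟨x, y⟩ ⟨hx, hy, hxy⟩ ⟨x', y'⟩ ⟨hx', hy', hxy'⟩ heq
    simp only [hd] at heq hx hy hx' hy' hxy hxy'
    have hpos : 0 < dist x y := by
      rw [dist_pos]
      rintro rfl
      exact lt_irrefl _ hxy
    by_cases hpair : ({x, y} : Set (EuclideanSpace ℝ (Fin n))) = {x', y'}
    · rcases Set.pair_eq_pair_iff.1 hpair with ⟨h1, h2⟩ | ⟨h1, h2⟩
      · rw [h1, h2]
      · rw [h1, h2] at hxy
        exact absurd hxy (not_lt.2 hxy'.le)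
    · exact absurd hpos (not_lt.2 (hcon x hx y hy x' hx' y' hy' hpair heq))
  have hemb : MeasurableEmbedding (T.domRestrict d) :=
    ContinuousOn.measurableEmbedding hT (by fun_prop) hinj
  set m : Measure T := (volume : Measure ℝ).toFinite.comap (T.domRestrict d) with hm
  have hfin : IsFiniteMeasure m := ⟨by
    rw [hm, hemb.comap_apply]; exact measure_lt_top _ _⟩
  have hmeas : Measurable (fun p : T => p.1.1) := measurable_fst.comp measurable_subtype_coe
  set μ : Measure (EuclideanSpace ℝ (Fin n)) := m.map (fun p : T => p.1.1) with hμ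
  obtain ⟨F, hFE, hFm, hF0, hFd⟩ := exists_null_subset μ E hE _ hdim
  refine (H F hFm hFd).ne' ?_
  rw [hμ, Measure.map_apply hmeas hFm, hm, hemb.comap_apply] at hF0
  have hF0' := absolutelyContinuous_toFinite (volume : Measure ℝ) hF0
  refine measure_mono_null ?_ (measure_union_null hF0' (measure_singleton (0 : ℝ)))
  rintro r ⟨x, hx, y, hy, rfl⟩
  rcases lt_trichotomy (e x) (e y) with h | h | h
  · left
    exact ⟨⟨(x, y), hFE hx, hFE hy, h⟩, hx, rfl⟩
  · right
    have := he.injective h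
    simp [this]
  · left
    exact ⟨⟨(y, x), hFE hy, hFE hx, h⟩, hy, dist_comm _ _⟩
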